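/- arXiv:2604.17223 — 2 statements merged into one kernel-verified Lean document; each statement's English description precedes it below -/
import Mathlib

section
/- Let β > 0, γ > 1, let ū : [0,1] → ℝ be continuous with ū(x) > 0 for all x ∈ [0,1], let d₁ ∈ (0,1) and P₁ > 0. Define d(x) = 1 + (d₁ − 1)·exp(−∫ₓ¹ βγ/ū(s) ds), P(x) = P₁·exp(∫ₓ¹ βγ/(d(s)ū(s)) ds), and ρ(x) = γP(x)/(d(x)ū(x)²) for x ∈ [0,1]. Then for all x ∈ [0,1]: 0 < d(x) < 1, P(x) > 0, ρ(x) > 0, P is differentiable with P′(x) = −βρ(x)ū(x), and ρ(x)ū(x)²/(γP(x)) = 1/d(x) > 1. -/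
open MeasureTheory in
theorem ContinuousOn.hasDerivWithinAt_integral_Icc_left {f : ℝ → ℝ} {a b x : ℝ}
    (hf : ContinuousOn f (Set.Icc a b)) (hx : x ∈ Set.Icc a b) :
    HasDerivWithinAt (fun y => ∫ s in y..b, f s) (-f x) (Set.Icc a b) x := by
  have : Fact (x ∈ Set.Icc a b) := ⟨hx⟩
  have hint : IntervalIntegrable f volume x b :=
    (hf.mono (Set.Icc_subset_Icc_left hx.1)).intervalIntegrable_of_Icc hx.2
  exact intervalIntegral.integral_hasDerivWithinAt_left hint
    (hf.stronglyMeasurableAtFilter_nhdsWithin measurableSet_Icc x) (hf x hx)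


/-- Existence construction of the supersonic background state: with
`d(x) = 1 + (d₁−1)exp(−∫ₓ¹ βγ/ū)`, `P(x) = P₁exp(∫ₓ¹ βγ/(dū))`, `ρ = γP/(dū²)`,
one has `0 < d < 1`, `P > 0`, `ρ > 0`, `P′ = −βρū` and `ρū²/(γP) = 1/d > 1` on `[0,1]`. -/
theorem stmt_6 (β γ : ℝ) (hβ : 0 < β) (hγ : 1 < γ) (ubar : ℝ → ℝ)
    (hu_cont : ContinuousOn ubar (Set.Icc 0 1))
    (hu_pos : ∀ x ∈ Set.Icc (0:ℝ) 1, 0 < ubar x)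
    (d₁ P₁ : ℝ) (hd₁ : d₁ ∈ Set.Ioo (0:ℝ) 1) (hP₁ : 0 < P₁)
    (d P ρ : ℝ → ℝ)
    (hd : ∀ x, d x = 1 + (d₁ - 1) * Real.exp (-∫ s in x..(1:ℝ), β * γ / ubar s))
    (hP : ∀ x, P x = P₁ * Real.exp (∫ s in x..(1:ℝ), β * γ / (d s * ubar s)))
    (hρ : ∀ x, ρ x = γ * P x / (d x * ubar x ^ 2)) :
    ∀ x ∈ Set.Icc (0:ℝ) 1,
      0 < d x ∧ d x < 1 ∧ 0 < P x ∧ 0 < ρ x ∧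
      HasDerivWithinAt P (-β * ρ x * ubar x) (Set.Icc 0 1) x ∧
      ρ x * ubar x ^ 2 / (γ * P x) = 1 / d x ∧ 1 < 1 / d x := by
  have hf : ContinuousOn (fun s => β * γ / ubar s) (Set.Icc 0 1) :=
    continuousOn_const.div hu_cont fun x hx => (hu_pos x hx).ne'
  have hd_bounds : ∀ x ∈ Set.Icc (0:ℝ) 1, 0 < d x ∧ d x < 1 := by
    intro x hx
    have hI : 0 ≤ ∫ s in x..(1:ℝ), β * γ / ubar s :=
      intervalIntegral.integral_nonneg hx.2 fun s hs => by
        have := hu_pos s ⟨hx.1.trans hs.1, hs.2⟩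
        positivity
    have hle : Real.exp (-∫ s in x..(1:ℝ), β * γ / ubar s) ≤ 1 := by
      rw [Real.exp_le_one_iff]
      linarith
    have hpos := Real.exp_pos (-∫ s in x..(1:ℝ), β * γ / ubar s)
    rw [hd x]
    constructor <;> nlinarith [hd₁.1, hd₁.2]
  have hd_cont : ContinuousOn d (Set.Icc 0 1) := by
    have hI : ContinuousOn (fun x => ∫ s in x..(1:ℝ), β * γ / ubar s) (Set.Icc 0 1) :=
      fun x hx => (hf.hasDerivWithinAt_integral_Icc_left hx).continuousWithinAt
    rw [funext hd]
    fun_prop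
  have hg : ContinuousOn (fun s => β * γ / (d s * ubar s)) (Set.Icc 0 1) :=
    continuousOn_const.div (hd_cont.mul hu_cont) fun x hx =>
      (mul_pos (hd_bounds x hx).1 (hu_pos x hx)).ne'
  intro x hx
  obtain ⟨hd0, hd1⟩ := hd_bounds x hx
  have hu := hu_pos x hx
  have hPx : 0 < P x := by
    rw [hP x]
    positivity
  have hderiv : HasDerivWithinAt P (-β * ρ x * ubar x) (Set.Icc 0 1) x := by
    have h := ((hg.hasDerivWithinAt_integral_Icc_left hx).exp).const_mul P₁
    rw [← funext hP, ← mul_assoc, ← hP x] at h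
    refine h.congr_deriv ?_
    rw [hρ x]
    field_simp
  refine ⟨hd0, hd1, hPx, ?_, hderiv, ?_, (one_lt_div hd0).2 hd1⟩
  · rw [hρ x]
    positivity
  · rw [hρ x]
    field_simp
end

section
/- Let Ω ⊆ ℝ² be open, γ > 1, β ∈ ℝ, and let ρ, u₁, u₂, P : Ω → ℝ be continuously differentiable with ρ > 0 and P > 0 on Ω. Suppose the mass equation ∂_{x₁}(ρu₁) + ∂_{x₂}(ρu₂) = 0 and the second momentum equation ∂_{x₁}(ρu₁u₂) + ∂_{x₂}(ρu₂² + P) + βρu₁ = 0 hold on Ω. Define S = log(P) − γ·log(ρ) and B = (1/2)(u₁² + u₂²) + γP/((γ−1)ρ). Then on Ω: u₁(∂_{x₁}u₂ − ∂_{x₂}u₁ + β) = ((B − (1/2)(u₁² + u₂²))/γ)·∂_{x₂}S − ∂_{x₂}B. -/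
/-- Partial derivative in the first coordinate of a function on `ℝ²`. -/
noncomputable def pdx (f : ℝ × ℝ → ℝ) (p : ℝ × ℝ) : ℝ :=
  deriv (fun t => f (t, p.2)) p.1

/-- Partial derivative in the second coordinate of a function on `ℝ²`. -/
noncomputable def pdy (f : ℝ × ℝ → ℝ) (p : ℝ × ℝ) : ℝ :=
  deriv (fun t => f (p.1, t)) p.2

/-- A function differentiable at `p` has `pdx f p` as its derivative along the first coordinate. -/
theorem hasDerivAt_pdx {f : ℝ × ℝ → ℝ} {p : ℝ × ℝ} (hf : DifferentiableAt ℝ f p) :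
    HasDerivAt (fun t => f (t, p.2)) (pdx f p) p.1 := by
  have hf' : DifferentiableAt ℝ f ((fun t : ℝ => (t, p.2)) p.1) := hf
  exact (hf'.comp p.1 (by fun_prop)).hasDerivAt

/-- A function differentiable at `p` has `pdy f p` as its derivative along the second coordinate. -/
theorem hasDerivAt_pdy {f : ℝ × ℝ → ℝ} {p : ℝ × ℝ} (hf : DifferentiableAt ℝ f p) :
    HasDerivAt (fun t => f (p.1, t)) (pdy f p) p.2 := by
  have hf' : DifferentiableAt ℝ f ((fun t : ℝ => (p.1, t)) p.2) := hf
  exact (hf'.comp p.2 (by fun_prop)).hasDerivAt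

/-- Crocco-type vorticity identity: from the mass equation and the second momentum
equation of the steady rotating Euler system one obtains
`u₁(∂₁u₂ − ∂₂u₁ + β) = ((B − ½|u|²)/γ)∂₂S − ∂₂B` on `Ω`. -/
theorem stmt_17 (Ω : Set (ℝ × ℝ)) (hΩ : IsOpen Ω) (γ β : ℝ) (hγ : 1 < γ)
    (ρ u₁ u₂ P : ℝ × ℝ → ℝ)
    (hρpos : ∀ p ∈ Ω, 0 < ρ p)
    (hPpos : ∀ p ∈ Ω, 0 < P p)
    (hρd : ContDiffOn ℝ 1 ρ Ω)
    (hu₁d : ContDiffOn ℝ 1 u₁ Ω)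
    (hu₂d : ContDiffOn ℝ 1 u₂ Ω)
    (hPd : ContDiffOn ℝ 1 P Ω) :
    let S : ℝ × ℝ → ℝ := fun p => Real.log (P p) - γ * Real.log (ρ p)
    let B : ℝ × ℝ → ℝ := fun p =>
      (1/2) * (u₁ p ^ 2 + u₂ p ^ 2) + γ * P p / ((γ - 1) * ρ p)
    (∀ p ∈ Ω, pdx (fun q => ρ q * u₁ q) p + pdy (fun q => ρ q * u₂ q) p = 0) →
    (∀ p ∈ Ω, pdx (fun q => ρ q * u₁ q * u₂ q) p
      + pdy (fun q => ρ q * u₂ q ^ 2 + P q) p + β * ρ p * u₁ p = 0) →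
    ∀ p ∈ Ω,
      u₁ p * (pdx u₂ p - pdy u₁ p + β)
        = ((B p - (1/2) * (u₁ p ^ 2 + u₂ p ^ 2)) / γ) * pdy S p - pdy B p := by
  intro S B hmass hmom p hp
  have hdiff {f : ℝ × ℝ → ℝ} (hf : ContDiffOn ℝ 1 f Ω) : DifferentiableAt ℝ f p :=
    (hf.contDiffAt (hΩ.mem_nhds hp)).differentiableAt one_ne_zero
  have hρ : ρ p ≠ 0 := (hρpos p hp).ne'
  have hP : P p ≠ 0 := (hPpos p hp).ne'
  have hγ₀ : γ ≠ 0 := by linarith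
  have hγ₁ : γ - 1 ≠ 0 := by linarith
  have ρx := hasDerivAt_pdx (hdiff hρd)
  have ρy := hasDerivAt_pdy (hdiff hρd)
  have u₁x := hasDerivAt_pdx (hdiff hu₁d)
  have u₁y := hasDerivAt_pdy (hdiff hu₁d)
  have u₂x := hasDerivAt_pdx (hdiff hu₂d)
  have u₂y := hasDerivAt_pdy (hdiff hu₂d)
  have Py := hasDerivAt_pdy (hdiff hPd)
  have mass := hmass p hp
  have mom := hmom p hp
  have mass_x : pdx (fun q => ρ q * u₁ q) p = _ := (ρx.mul u₁x).deriv
  have mass_y : pdy (fun q => ρ q * u₂ q) p = _ := (ρy.mul u₂y).deriv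
  have mom_x : pdx (fun q => ρ q * u₁ q * u₂ q) p = _ := ((ρx.mul u₁x).mul u₂x).deriv
  have mom_y : pdy (fun q => ρ q * u₂ q ^ 2 + P q) p = _ :=
    ((ρy.mul (u₂y.pow 2)).add Py).deriv
  have S_y : pdy S p = _ := ((Py.log hP).sub ((ρy.log hρ).const_mul γ)).deriv
  have B_y : pdy B p = _ :=
    ((((u₁y.pow 2).add (u₂y.pow 2)).const_mul (1 / 2)).add
      ((Py.const_mul γ).div (ρy.const_mul (γ - 1)) (mul_ne_zero hγ₁ hρ))).deriv
  rw [mass_x, mass_y] at mass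
  rw [mom_x, mom_y] at mom
  rw [S_y, B_y]
  simp only [B, Pi.mul_apply, Pi.pow_apply, Prod.mk.eta] at mass mom ⊢
  have velocity : ρ p * (u₁ p * (pdx u₂ p + β) + u₂ p * pdy u₂ p) = -pdy P p := by
    norm_num at mom
    linear_combination mom - u₂ p * mass
  norm_num
  field_simp
  linear_combination ρ p * (γ - 1) * velocity
end
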